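/- Let Δ be a finite type with |Δ| = n ≥ 1 and let 0 ≤ k ≤ n. Among the subsets S of Δ × Δ satisfying (for every x there exists y with (x,y) ∈ S) and |S| = n, the number of those with exactly k 'diagonal' pairs (x,x) ∈ S equals C(n,k)·(n−1)^{n−k}. Hence, conditioned on the hard constraint ∀x∃y f(x,y) and the cardinality constraint |f| = |Δ|, the count N(f(x,x)) of diagonal ground atoms is distributed as the number of fixed points of a uniformly random function on Δ. -/

import Mathlib

open Finset

theorem graphMap_injective {α β : Type*} (f : α → β) :
    Function.Injective fun x => (x, f x) :=
  fun _ _ h => congrArg Prod.fst h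

/-- The graph of a function between finite types, as a finset of pairs. -/
def finsetGraph {α β : Type*} [Fintype α] (f : α → β) : Finset (α × β) :=
  univ.map ⟨fun x => (x, f x), graphMap_injective f⟩

@[simp]
theorem mem_finsetGraph {α β : Type*} [Fintype α] (f : α → β) (p : α × β) :
    p ∈ finsetGraph f ↔ f p.1 = p.2 := by
  rcases p with ⟨a, b⟩
  simp [finsetGraph]

theorem card_finsetGraph {α β : Type*} [Fintype α] (f : α → β) :
    (finsetGraph f).card = Fintype.card α := by
  simp [finsetGraph]

theorem finsetGraph_injective {α β : Type*} [Fintype α] :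
    Function.Injective (finsetGraph : (α → β) → Finset (α × β)) := by
  intro f g h
  funext x
  have hx : (x, f x) ∈ finsetGraph g := h ▸ (mem_finsetGraph f _).2 rfl
  exact ((mem_finsetGraph g _).1 hx).symm

/-- A total relation on `α` with exactly `|α|` pairs is the graph of a function. -/
theorem exists_finsetGraph_eq {α β : Type*} [Fintype α] {S : Finset (α × β)}
    (htotal : ∀ x, ∃ y, (x, y) ∈ S) (hcard : S.card = Fintype.card α) :
    ∃ f : α → β, finsetGraph f = S := by
  choose f hf using htotal
  refine ⟨f, eq_of_subset_of_card_le ?_ (by rw [hcard, card_finsetGraph])⟩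
  rintro ⟨x, y⟩ h
  obtain rfl : f x = y := (mem_finsetGraph f _).1 h
  exact hf x

theorem card_filter_diagonal_finsetGraph {α : Type*} [Fintype α] [DecidableEq α] (f : α → α) :
    ((finsetGraph f).filter fun p : α × α => p.1 = p.2).card =
      (univ.filter fun x : α => f x = x).card := by
  rw [finsetGraph, filter_map, card_map]
  simp [eq_comm]

/-- The number of self-maps of `α` whose set of fixed points is exactly `T`. -/
theorem card_filter_fixedPoints_eq {α : Type*} [Fintype α] [DecidableEq α] (T : Finset α) :
    (univ.filter fun f : α → α => (univ.filter fun x : α => f x = x) = T).card =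
      (Fintype.card α - 1) ^ (Fintype.card α - T.card) := by
  have h : (univ.filter fun f : α → α => (univ.filter fun x : α => f x = x) = T) =
      Fintype.piFinset fun x => if x ∈ T then {x} else univ.erase x := by
    ext f
    simp only [mem_filter, mem_univ, true_and, Fintype.mem_piFinset, Finset.ext_iff]
    refine forall_congr' fun x => ?_
    by_cases hx : x ∈ T <;> simp [hx]
  have hfactor (x : α) : (if x ∈ T then {x} else univ.erase x : Finset α).card =
      if x ∈ T then 1 else Fintype.card α - 1 := by
    split_ifs <;> simp
  simp only [h, Fintype.card_piFinset, hfactor, prod_ite, prod_const_one, one_mul, prod_const]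
  rw [← card_compl]
  congr 2
  ext x
  simp

/-- The number of self-maps of `α` with exactly `k` fixed points. -/
theorem card_filter_card_fixedPoints_eq (α : Type*) [Fintype α] [DecidableEq α] (k : ℕ) :
    (univ.filter fun f : α → α => (univ.filter fun x : α => f x = x).card = k).card =
      (Fintype.card α).choose k * (Fintype.card α - 1) ^ (Fintype.card α - k) := by
  rw [card_eq_sum_card_fiberwise (f := fun f : α → α => univ.filter fun x : α => f x = x)
    (t := powersetCard k univ) (by intro f hf; simpa [mem_powersetCard] using hf)]
  have hfiber (T : Finset α) (hT : T ∈ powersetCard k univ) :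
      ((univ.filter fun f : α → α => (univ.filter fun x : α => f x = x).card = k).filter
        fun f => (univ.filter fun x : α => f x = x) = T).card =
      (Fintype.card α - 1) ^ (Fintype.card α - k) := by
    have hTk := (mem_powersetCard.1 hT).2
    rw [← hTk, ← card_filter_fixedPoints_eq T, filter_filter]
    congr 1
    ext f
    simp only [mem_filter, mem_univ, true_and, and_iff_right_iff_imp]
    exact congrArg card
  rw [sum_congr rfl hfiber, sum_const, card_powersetCard, card_univ, smul_eq_mul]

/-- Lemma 1 combined with Example 1 of the paper: on a finite domain `Δ` with `|Δ| = n`,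
the number of subsets `S ⊆ Δ × Δ` that are total (`∀ x ∃ y, (x,y) ∈ S`), have `|S| = n`,
and contain exactly `k` diagonal pairs `(x,x)` equals `C(n,k) · (n−1)^(n−k)`; hence this
count agrees with the number of functions `Δ → Δ` with exactly `k` fixed points. -/
theorem count_total_relations_with_k_diagonal (Δ : Type*) [Fintype Δ] [DecidableEq Δ]
    (n k : ℕ) (hn : 1 ≤ n) (hcard : Fintype.card Δ = n) (hkn : k ≤ n) :
    (Finset.univ.filter (fun S : Finset (Δ × Δ) =>
        (∀ x : Δ, ∃ y : Δ, (x, y) ∈ S) ∧ S.card = n ∧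
          (S.filter fun p : Δ × Δ => p.1 = p.2).card = k)).card
      = Nat.choose n k * (n - 1) ^ (n - k) ∧
    (Finset.univ.filter (fun S : Finset (Δ × Δ) =>
        (∀ x : Δ, ∃ y : Δ, (x, y) ∈ S) ∧ S.card = n ∧
          (S.filter fun p : Δ × Δ => p.1 = p.2).card = k)).card
      = (Finset.univ.filter (fun f : Δ → Δ =>
          (Finset.univ.filter fun x : Δ => f x = x).card = k)).card := by
  subst hcard
  have hgraph : (Finset.univ.filter (fun S : Finset (Δ × Δ) =>
        (∀ x : Δ, ∃ y : Δ, (x, y) ∈ S) ∧ S.card = Fintype.card Δ ∧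
          (S.filter fun p : Δ × Δ => p.1 = p.2).card = k)) =
      (Finset.univ.filter (fun f : Δ → Δ =>
          (Finset.univ.filter fun x : Δ => f x = x).card = k)).map
        ⟨finsetGraph, finsetGraph_injective⟩ := by
    ext S
    simp only [mem_filter, mem_univ, true_and, mem_map, Function.Embedding.coeFn_mk]
    constructor
    · rintro ⟨htotal, hS, hk⟩
      obtain ⟨f, rfl⟩ := exists_finsetGraph_eq htotal hS
      exact ⟨f, by rwa [card_filter_diagonal_finsetGraph] at hk, rfl⟩
    · rintro ⟨f, hk, rfl⟩
      exact ⟨fun x => ⟨f x, by simp⟩, card_finsetGraph f,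
        by rwa [card_filter_diagonal_finsetGraph]⟩
  rw [hgraph, card_map]
  exact ⟨card_filter_card_fixedPoints_eq Δ k, rfl⟩
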